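/- Rate of entropy increase under partial diffusion (Lemma 4.3): Let m, n ≥ 1 and let M_AB be a real symmetric positive-definite matrix of size 2(m+n). Let S be a symplectic matrix and λ₁,…,λ_{m+n} reals with S·M_AB·Sᵀ = D_{m+n}(λ), and assume λ_ℓ > 1 for all ℓ. Then the function t ↦ E(M_AB + t·(I_A⊕0_B)) is differentiable at t = 0 with derivative (1/4)·Σ_{ℓ=1}^{m+n} β(λ_ℓ)·tr([S·(I_A⊕0_B)·Sᵀ]^{(ℓ)}), where [Z]^{(ℓ)} denotes the 2×2 diagonal block of Z with rows and columns 2ℓ−1 and 2ℓ. -/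

import Mathlib

open scoped Classical ComplexOrder

noncomputable section

/-- The function `g(x) = (x+1)·log(x+1) − x·log x` (with `g 0 = 0` since `log 0 = 0`). -/
def gFn (x : ℝ) : ℝ := (x + 1) * Real.log (x + 1) - x * Real.log x

/-- Single-mode entropy as a function of the symplectic eigenvalue: `G(λ) = g((λ−1)/2)`. -/
def GFn (lam : ℝ) : ℝ := gFn ((lam - 1) / 2)

/-- Inverse temperature `β(λ) = log((λ+1)/(λ−1))`. -/
def betaFn (lam : ℝ) : ℝ := Real.log ((lam + 1) / (lam - 1))

/-- The standard symplectic form matrix on `ℝ^d` (for even `d = 2N` this is the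
block-diagonal matrix with `N` diagonal blocks `[[0,1],[-1,0]]`). -/
def Jmat (d : ℕ) : Matrix (Fin d) (Fin d) ℝ := fun i j =>
  if (i : ℕ) % 2 = 0 ∧ (j : ℕ) = (i : ℕ) + 1 then 1
  else if (j : ℕ) % 2 = 0 ∧ (i : ℕ) = (j : ℕ) + 1 then -1 else 0

/-- A real `d×d` matrix is symplectic if `S·J·Sᵀ = J`. -/
def IsSymplectic {d : ℕ} (S : Matrix (Fin d) (Fin d) ℝ) : Prop :=
  S * Jmat d * S.transpose = Jmat d

/-- The doubled diagonal matrix `D(λ) = diag(λ₀,λ₀,λ₁,λ₁,…)`. -/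
def Dmat (d : ℕ) (lam : ℕ → ℝ) : Matrix (Fin d) (Fin d) ℝ :=
  Matrix.diagonal fun i => lam ((i : ℕ) / 2)

/-- A valid quantum covariance matrix: `M` symmetric with `M + i·J ⪰ 0`. -/
def IsQCov {d : ℕ} (M : Matrix (Fin d) (Fin d) ℝ) : Prop :=
  M.IsSymm ∧
    (M.map (Complex.ofReal) + Complex.I • (Jmat d).map Complex.ofReal).PosSemidef

/-- Entropy functional `E(M) = Σⱼ G(λⱼ)` where `λⱼ` are the symplectic eigenvalues of `M`:
the eigenvalues of `i·J·M` are `±λⱼ`, so `E(M) = (1/2)·Σ_{μ root of charpoly} G(|Re μ|)`. -/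
def Ent {d : ℕ} (M : Matrix (Fin d) (Fin d) ℝ) : ℝ :=
  ((Matrix.charpoly (Complex.I • ((Jmat d * M).map Complex.ofReal))).roots.map
    fun μ => GFn |μ.re|).sum / 2

/-- The matrix `I_A ⊕ 0_B`: identity on the first `a` coordinates, zero on the rest. -/
def IA0B (d a : ℕ) : Matrix (Fin d) (Fin d) ℝ :=
  Matrix.diagonal fun i => if (i : ℕ) < a then 1 else 0

/-- Assemble a symmetric 2×2 block matrix `[[A, K], [Kᵀ, B]]`. -/
def assemble2 {a b : ℕ} (A : Matrix (Fin a) (Fin a) ℝ) (K : Matrix (Fin a) (Fin b) ℝ)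
    (B : Matrix (Fin b) (Fin b) ℝ) : Matrix (Fin (a + b)) (Fin (a + b)) ℝ := fun i j =>
  if hi : (i : ℕ) < a then
    if hj : (j : ℕ) < a then A ⟨i, hi⟩ ⟨j, hj⟩
    else K ⟨i, hi⟩ ⟨(j : ℕ) - a, by have := j.isLt; omega⟩
  else
    if hj : (j : ℕ) < a then K ⟨j, hj⟩ ⟨(i : ℕ) - a, by have := i.isLt; omega⟩
    else B ⟨(i : ℕ) - a, by have := i.isLt; omega⟩ ⟨(j : ℕ) - a, by have := j.isLt; omega⟩

/-- Assemble the symmetric 3×3 block matrix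
`[[Y, K₁, K₂], [K₁ᵀ, B₁, 0], [K₂ᵀ, 0, B₂]]`. -/
def assemble3 {a b c : ℕ} (Y : Matrix (Fin a) (Fin a) ℝ)
    (K₁ : Matrix (Fin a) (Fin b) ℝ) (K₂ : Matrix (Fin a) (Fin c) ℝ)
    (B₁ : Matrix (Fin b) (Fin b) ℝ) (B₂ : Matrix (Fin c) (Fin c) ℝ) :
    Matrix (Fin (a + b + c)) (Fin (a + b + c)) ℝ := fun i j =>
  if hi : (i : ℕ) < a then
    if hj : (j : ℕ) < a then Y ⟨i, hi⟩ ⟨j, hj⟩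
    else if hj' : (j : ℕ) < a + b then K₁ ⟨i, hi⟩ ⟨(j : ℕ) - a, by omega⟩
    else K₂ ⟨i, hi⟩ ⟨(j : ℕ) - a - b, by have := j.isLt; omega⟩
  else if hi' : (i : ℕ) < a + b then
    if hj : (j : ℕ) < a then K₁ ⟨j, hj⟩ ⟨(i : ℕ) - a, by omega⟩
    else if hj' : (j : ℕ) < a + b then
      B₁ ⟨(i : ℕ) - a, by omega⟩ ⟨(j : ℕ) - a, by omega⟩
    else 0
  else
    if hj : (j : ℕ) < a then K₂ ⟨j, hj⟩ ⟨(i : ℕ) - a - b, by have := i.isLt; omega⟩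
    else if hj' : (j : ℕ) < a + b then 0
    else B₂ ⟨(i : ℕ) - a - b, by have := i.isLt; omega⟩
      ⟨(j : ℕ) - a - b, by have := j.isLt; omega⟩


section Analytic

open Matrix intervalIntegral

lemma hasDerivAt_det_add_smul {n : Type*} [Fintype n] [DecidableEq n] (B C : Matrix n n ℂ)
    (t : ℝ) (h : (B + (t : ℂ) • C).det ≠ 0) :
    HasDerivAt (fun u : ℝ => (B + (u : ℂ) • C).det)
      ((B + (t : ℂ) • C).det * ((B + (t : ℂ) • C)⁻¹ * C).trace) t := by
  set A := B + (t : ℂ) • C with hA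
  set p : Polynomial ℂ := (1 + (Polynomial.X : Polynomial ℂ) • (A⁻¹ * C).map Polynomial.C).det
  have hp : HasDerivAt (fun z : ℂ => p.eval z) ((A⁻¹ * C).trace) 0 := by
    have := p.hasDerivAt 0
    rwa [derivative_det_one_add_X_smul] at this
  have heval (z : ℂ) : A.det * p.eval z = (A + z • C).det := by
    have : p.eval z = (1 + z • (A⁻¹ * C)).det := by
      rw [← Polynomial.coe_evalRingHom, RingHom.map_det]
      congr 1
      ext i j
      simp [-Matrix.map_mul, Matrix.one_apply, apply_ite, mul_comm z]
    rw [this, ← Matrix.det_mul, mul_add, Matrix.mul_smul, ← mul_assoc,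
      Matrix.mul_nonsing_inv _ (isUnit_iff_ne_zero.mpr h)]
    simp
  have h1 : HasDerivAt (fun u : ℝ => p.eval ((u - t : ℝ) : ℂ)) ((A⁻¹ * C).trace) t := by
    have h2 : HasDerivAt (fun u : ℝ => ((u - t : ℝ) : ℂ)) 1 t := by
      simpa using ((hasDerivAt_id t).sub_const t).ofReal_comp
    have h3 : HasDerivAt (fun z : ℂ => p.eval z) ((A⁻¹ * C).trace) ((t - t : ℝ) : ℂ) := by
      simpa using hp
    simpa [Function.comp_def] using! h3.comp t h2
  refine (h1.const_mul A.det).congr_of_eventuallyEq (Filter.Eventually.of_forall fun u => ?_)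
  simp only [heval]
  congr 1
  rw [hA, add_assoc, ← add_smul]
  congr 2
  push_cast
  ring

lemma hasDerivAt_log_norm {f : ℝ → ℂ} {f' : ℂ} {t : ℝ} (hf : HasDerivAt f (f t * f') t)
    (h : f t ≠ 0) : HasDerivAt (fun u => Real.log ‖f u‖) f'.re t := by
  have h1 := (hf.norm_sq.log (by positivity)).const_mul (1 / 2)
  have h2 : (1 / 2 : ℝ) * (2 * inner ℝ (f t) (f t * f') / ‖f t‖ ^ 2) = f'.re := by
    have : inner ℝ (f t) (f t * f') = ‖f t‖ ^ 2 * f'.re := by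
      rw [← Complex.normSq_eq_norm_sq, Complex.inner]
      simp [Complex.normSq_apply]
      ring
    rw [this]
    have : ‖f t‖ ≠ 0 := by positivity
    field_simp
  rw [h2] at h1
  refine h1.congr_of_eventuallyEq (Filter.Eventually.of_forall fun u => ?_)
  simp only [Real.log_pow]
  push_cast
  ring

lemma eventually_det_ne_zero {n : Type*} [Fintype n] [DecidableEq n] (A C : Matrix n n ℂ)
    (h : ∀ s ∈ Set.Icc (-1 : ℝ) 1, (scalar n (s : ℂ) - A).det ≠ 0) :
    ∀ᶠ t : ℝ in nhds 0, ∀ s ∈ Set.Icc (-1 : ℝ) 1,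
      (scalar n (s : ℂ) - A + (t : ℂ) • C).det ≠ 0 := by
  refine isCompact_Icc.eventually_forall_of_forall_eventually fun s hs => ?_
  have hc : Continuous fun z : ℝ × ℝ =>
      (scalar n (z.2 : ℂ) - A + (z.1 : ℂ) • C).det := by
    simp only [scalar_apply]
    fun_prop
  exact hc.continuousAt.eventually_ne (by simpa using h s hs)

lemma hasDerivAt_integral_log_norm_det {n : Type*} [Fintype n] [DecidableEq n]
    (A C : Matrix n n ℂ)
    (h : ∀ s ∈ Set.Icc (-1 : ℝ) 1, (scalar n (s : ℂ) - A).det ≠ 0) :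
    HasDerivAt
      (fun t : ℝ => ∫ s in (-1 : ℝ)..1, Real.log ‖(scalar n (s : ℂ) - A + (t : ℂ) • C).det‖)
      (∫ s in (-1 : ℝ)..1, (((scalar n (s : ℂ) - A)⁻¹ * C).trace).re) 0 := by
  obtain ⟨ε, hε, hball⟩ := Metric.eventually_nhds_iff_ball.mp (eventually_det_ne_zero A C h)
  set K : Set (ℝ × ℝ) := Metric.closedBall 0 (ε / 2) ×ˢ Set.Icc (-1 : ℝ) 1
  have hK : IsCompact K := (isCompact_closedBall _ _).prod isCompact_Icc
  set B : ℝ × ℝ → Matrix n n ℂ := fun z => scalar n (z.2 : ℂ) - A + (z.1 : ℂ) • C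
  have hBc : Continuous B := by
    simp only [B, scalar_apply]
    fun_prop
  have hne : ∀ z ∈ K, (B z).det ≠ 0 := fun z hz =>
    hball _ (Metric.closedBall_subset_ball (by linarith) hz.1) _ hz.2
  have hF : ContinuousOn (fun z => Real.log ‖(B z).det‖) K :=
    (hBc.matrix_det.norm.continuousOn).log fun z hz => norm_ne_zero_iff.mpr (hne z hz)
  have hF' : ContinuousOn (fun z => (((B z)⁻¹ * C).trace).re) K := by
    have : ContinuousOn (fun z => (B z)⁻¹) K := by
      simp only [Matrix.inv_def, Ring.inverse_eq_inv']
      exact (hBc.matrix_det.continuousOn.inv₀ hne).smul hBc.matrix_adjugate.continuousOn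
    have h2 : Continuous fun D : Matrix n n ℂ => ((D * C).trace).re :=
      Complex.continuous_re.comp (by fun_prop)
    exact h2.comp_continuousOn this
  obtain ⟨M, hM⟩ := hK.exists_bound_of_continuousOn hF'
  have slice {f : ℝ × ℝ → ℝ} (hf : ContinuousOn f K) {t : ℝ}
      (ht : t ∈ Metric.closedBall (0 : ℝ) (ε / 2)) :
      ContinuousOn (fun s => f (t, s)) (Set.uIcc (-1) 1) := by
    rw [Set.uIcc_of_le (by norm_num)]
    exact hf.comp (by fun_prop) fun s hs => ⟨ht, hs⟩
  have h0 : (0 : ℝ) ∈ Metric.closedBall (0 : ℝ) (ε / 2) := Metric.mem_closedBall_self (by linarith)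
  have hsub : Set.uIoc (-1 : ℝ) 1 ⊆ Set.Icc (-1) 1 := by
    rw [Set.uIoc_of_le (by norm_num)]; exact Set.Ioc_subset_Icc_self
  have key := (hasDerivAt_integral_of_dominated_loc_of_deriv_le (μ := MeasureTheory.volume)
    (a := -1) (b := 1) (x₀ := (0 : ℝ)) (bound := fun _ => M)
    (F := fun t s => Real.log ‖(B (t, s)).det‖)
    (F' := fun t s => (((B (t, s))⁻¹ * C).trace).re)
    (Metric.closedBall_mem_nhds (0 : ℝ) (half_pos hε)) ?_ ?_ ?_ ?_ ?_ ?_).2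
  · simpa [B] using key
  · filter_upwards [Metric.closedBall_mem_nhds (0 : ℝ) (half_pos hε)] with t ht
    exact (intervalIntegrable_iff.mp (slice hF ht).intervalIntegrable).aestronglyMeasurable
  · exact (slice hF h0).intervalIntegrable
  · exact (intervalIntegrable_iff.mp (slice hF' h0).intervalIntegrable).aestronglyMeasurable
  · exact Filter.Eventually.of_forall fun s hs t ht => hM (t, s) ⟨ht, hsub hs⟩
  · exact intervalIntegrable_const
  · refine Filter.Eventually.of_forall fun s hs t ht => ?_
    have hn := hne (t, s) ⟨ht, hsub hs⟩
    exact hasDerivAt_log_norm (hasDerivAt_det_add_smul (scalar n (s : ℂ) - A) C t hn) hn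

lemma integral_log_abs_sub {x : ℝ} (hx : 1 < |x|) :
    ∫ s in (-1 : ℝ)..1, Real.log |s - x| = 2 * GFn |x| - 2 * (1 - Real.log 2) := by
  simp only [Real.log_abs]
  rw [integral_comp_sub_right (fun s => Real.log s), integral_log]
  have key (y : ℝ) (hy : 1 < y) : GFn y =
      ((y + 1) * Real.log (y + 1) - (y - 1) * Real.log (y - 1)) / 2 - Real.log 2 := by
    have h1 : (y - 1) / 2 + 1 = (y + 1) / 2 := by ring
    rw [GFn, gFn, h1, Real.log_div (by linarith) (by norm_num),
      Real.log_div (by linarith) (by norm_num)]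
    ring
  rw [key _ hx]
  rcases abs_cases x with ⟨h, _⟩ | ⟨h, _⟩ <;> rw [h]
  · rw [← Real.log_neg_eq_log (1 - x), ← Real.log_neg_eq_log (-1 - x),
      show -(1 - x) = x - 1 by ring, show -(-1 - x) = x + 1 by ring]
    ring
  · rw [show -x + 1 = 1 - x by ring, show -x - 1 = -1 - x by ring]
    ring

lemma integral_log_norm_multiset_prod (R : Multiset ℂ) (hR : ∀ z ∈ R, z.im = 0 ∧ 1 < |z.re|) :
    IntervalIntegrable (fun s : ℝ => Real.log ‖(R.map fun z => (s : ℂ) - z).prod‖)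
      MeasureTheory.volume (-1) 1 ∧
    ∫ s in (-1 : ℝ)..1, Real.log ‖(R.map fun z => (s : ℂ) - z).prod‖ =
      2 * (R.map fun z => GFn |z.re|).sum - R.card * (2 * (1 - Real.log 2)) := by
  induction R using Multiset.induction with
  | empty => simp
  | cons z R ih =>
    obtain ⟨ih1, ih2⟩ := ih fun w hw => hR w (Multiset.mem_cons_of_mem hw)
    obtain ⟨him, hre⟩ := hR z (Multiset.mem_cons_self z R)
    have hzs (s : ℝ) : ‖(s : ℂ) - z‖ = |s - z.re| := by
      have : (s : ℂ) - z = ((s - z.re : ℝ) : ℂ) := by apply Complex.ext <;> simp [him]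
      rw [this, Complex.norm_real, Real.norm_eq_abs]
    have hne : ∀ w ∈ z ::ₘ R, ∀ s ∈ Set.uIcc (-1 : ℝ) 1, (s : ℂ) - w ≠ 0 := by
      intro w hw s hs h0
      rw [Set.uIcc_of_le (by norm_num)] at hs
      have h1 := (hR w hw).2
      have : w.re = s := by rw [← sub_eq_zero.mp h0]; simp
      rw [this] at h1
      exact absurd (abs_le.mpr hs) (not_le.mpr h1)
    have hsplit : ∀ s ∈ Set.uIcc (-1 : ℝ) 1,
        Real.log ‖((z ::ₘ R).map fun z => (s : ℂ) - z).prod‖ =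
          Real.log |s - z.re| + Real.log ‖(R.map fun z => (s : ℂ) - z).prod‖ := by
      intro s hs
      rw [Multiset.map_cons, Multiset.prod_cons, norm_mul, Real.log_mul, hzs]
      · exact norm_ne_zero_iff.mpr (hne z (Multiset.mem_cons_self z R) s hs)
      · refine norm_ne_zero_iff.mpr (Multiset.prod_ne_zero fun h => ?_)
        obtain ⟨w, hw, h0⟩ := Multiset.mem_map.mp h
        exact hne w (Multiset.mem_cons_of_mem hw) s hs h0
    have hint : IntervalIntegrable (fun s => Real.log |s - z.re|) MeasureTheory.volume (-1) 1 := by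
      refine ContinuousOn.intervalIntegrable (ContinuousOn.log (by fun_prop) fun s hs => ?_)
      rw [← hzs]
      exact norm_ne_zero_iff.mpr (hne z (Multiset.mem_cons_self z R) s hs)
    refine ⟨(hint.add ih1).congr fun s hs => (hsplit s (Set.uIoc_subset_uIcc hs)).symm, ?_⟩
    rw [integral_congr hsplit, integral_add hint ih1, ih2, integral_log_abs_sub hre]
    simp
    ring

lemma integral_div_sq_sub_sq {x : ℝ} (hx : 1 < x) :
    ∫ s in (-1 : ℝ)..1, x / (x ^ 2 - s ^ 2) = betaFn x := by
  have hd : ∀ s ∈ Set.uIcc (-1 : ℝ) 1,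
      HasDerivAt (fun s => (Real.log (x + s) - Real.log (x - s)) / 2) (x / (x ^ 2 - s ^ 2)) s := by
    intro s hs
    rw [Set.uIcc_of_le (by norm_num)] at hs
    have h1 : x + s ≠ 0 := by linarith [hs.1]
    have h2 : x - s ≠ 0 := by linarith [hs.2]
    have := ((((hasDerivAt_id s).const_add x).log h1).sub
      (((hasDerivAt_id s).const_sub x).log h2)).div_const 2
    refine this.congr_deriv ?_
    rw [show x ^ 2 - s ^ 2 = (x + s) * (x - s) by ring]
    simp only [id]
    field_simp
    ring
  rw [integral_eq_sub_of_hasDerivAt hd, betaFn, Real.log_div (by linarith) (by linarith)]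
  · rw [show x + -1 = x - 1 by ring, sub_neg_eq_add]
    ring
  · refine ContinuousOn.intervalIntegrable (ContinuousOn.div (by fun_prop) (by fun_prop) ?_)
    intro s hs
    rw [Set.uIcc_of_le (by norm_num)] at hs
    nlinarith [hs.1, hs.2]

end Analytic

section Algebraic

open Matrix

lemma im_eq_zero_of_isRoot_charpoly_mul {n : Type*} [Fintype n] [DecidableEq n]
    {A H : Matrix n n ℂ} (hA : A.IsHermitian) (hH : H.IsHermitian)
    (hpos : ∀ v, v ≠ 0 → star v ⬝ᵥ (H *ᵥ v) ≠ 0) {μ : ℂ} (hμ : (A * H).charpoly.IsRoot μ) :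
    μ.im = 0 := by
  rw [Polynomial.IsRoot, eval_charpoly] at hμ
  obtain ⟨v, hv, hv0⟩ := exists_mulVec_eq_zero_iff.mpr hμ
  have hAv : A *ᵥ (H *ᵥ v) = μ • v := by
    rw [sub_mulVec, sub_eq_zero] at hv0
    rw [mulVec_mulVec, ← hv0]
    ext i
    simp [scalar_apply, mulVec_diagonal]
  have hherm {B : Matrix n n ℂ} (hB : B.IsHermitian) (w : n → ℂ) :
      star (star w ⬝ᵥ (B *ᵥ w)) = star w ⬝ᵥ (B *ᵥ w) := by
    rw [← star_dotProduct, star_mulVec, hB.eq, ← dotProduct_mulVec]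
  set q := star v ⬝ᵥ (H *ᵥ v) with hq
  have h1 : star (H *ᵥ v) ⬝ᵥ (A *ᵥ (H *ᵥ v)) = μ * q := by
    rw [hAv, dotProduct_smul, smul_eq_mul, star_mulVec, hH.eq, ← dotProduct_mulVec]
  have h2 := hherm hA (H *ᵥ v)
  rw [h1, star_mul', hq, hherm hH v] at h2
  exact Complex.conj_eq_iff_im.mp (mul_right_cancel₀ (hpos v hv) h2)

lemma eventually_dotProduct_mulVec_ne_zero {n : Type*} [Fintype n] {A : Matrix n n ℂ}
    (hA : A.PosDef) (X : Matrix n n ℂ) :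
    ∀ᶠ t : ℝ in nhds 0, ∀ v, v ≠ 0 → star v ⬝ᵥ ((A + (t : ℂ) • X) *ᵥ v) ≠ 0 := by
  have hev : ∀ᶠ t : ℝ in nhds 0, ∀ v ∈ Metric.sphere (0 : n → ℂ) 1,
      star v ⬝ᵥ ((A + (t : ℂ) • X) *ᵥ v) ≠ 0 := by
    refine (isCompact_sphere _ _).eventually_forall_of_forall_eventually fun v hv => ?_
    have hc : Continuous fun z : ℝ × (n → ℂ) =>
        star z.2 ⬝ᵥ ((A + (z.1 : ℂ) • X) *ᵥ z.2) := by
      fun_prop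
    refine hc.continuousAt.eventually_ne ?_
    have hv0 : v ≠ 0 := by
      rintro rfl
      simp at hv
    simpa using (hA.dotProduct_mulVec_pos hv0).ne'
  filter_upwards [hev] with t ht v hv h0
  refine ht (((‖v‖⁻¹ : ℝ) : ℂ) • v) ?_ ?_
  · simp [norm_smul, hv]
  · rw [mulVec_smul, dotProduct_smul, star_smul, smul_dotProduct, h0]
    simp

lemma Jmat_apply_of_even {d : ℕ} {i : Fin d} (hi : (i : ℕ) % 2 = 0) (j : Fin d) :
    Jmat d i j = if (j : ℕ) = i + 1 then 1 else 0 := by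
  unfold Jmat
  split_ifs <;> first | rfl | omega

lemma Jmat_apply_of_odd {d : ℕ} {i : Fin d} (hi : (i : ℕ) % 2 = 1) (j : Fin d) :
    Jmat d i j = if (i : ℕ) = j + 1 then -1 else 0 := by
  unfold Jmat
  split_ifs <;> first | rfl | omega

lemma Jmat_mul_self (N : ℕ) : Jmat (2 * N) * Jmat (2 * N) = -1 := by
  ext i j
  rw [mul_apply]
  rcases Nat.mod_two_eq_zero_or_one i with hi | hi
  · rw [Finset.sum_eq_single ⟨i + 1, by omega⟩]
    · rw [Jmat_apply_of_even hi, Jmat_apply_of_odd (by simp; omega)]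
      simp only [Matrix.neg_apply, one_apply, Fin.ext_iff]
      split_ifs <;> first | omega | simp
    · intro k _ hk
      rw [Jmat_apply_of_even hi, if_neg (fun h => hk (Fin.ext h)), zero_mul]
    · simp
  · rw [Finset.sum_eq_single ⟨i - 1, by omega⟩]
    · rw [Jmat_apply_of_odd hi, Jmat_apply_of_even (by simp; omega)]
      simp only [Matrix.neg_apply, one_apply, Fin.ext_iff]
      split_ifs <;> first | omega | simp
    · intro k _ hk
      rw [Jmat_apply_of_odd hi, if_neg (fun h => hk (Fin.ext (by simp; omega))), zero_mul]
    · simp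

lemma Jmat_transpose (d : ℕ) : (Jmat d)ᵀ = -Jmat d := by
  ext i j
  simp only [transpose_apply, Matrix.neg_apply, Jmat]
  split_ifs <;> first | omega | simp

lemma Jmat_mul_diagonal (d : ℕ) (f : ℕ → ℝ) :
    Jmat d * diagonal (fun i : Fin d => f (i / 2)) =
      diagonal (fun i : Fin d => f (i / 2)) * Jmat d := by
  ext i j
  rw [mul_diagonal, diagonal_mul, mul_comm]
  by_cases h : (i : ℕ) / 2 = j / 2
  · rw [h]
  · have : Jmat d i j = 0 := by
      unfold Jmat
      split_ifs <;> first | rfl | omega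
    simp [this]

lemma IsSymplectic.transpose_mul_Jmat_mul {N : ℕ} {S : Matrix (Fin (2 * N)) (Fin (2 * N)) ℝ}
    (hS : IsSymplectic S) : Sᵀ * Jmat (2 * N) * S = Jmat (2 * N) := by
  set J := Jmat (2 * N)
  have hJ : J * J = -1 := Jmat_mul_self N
  have h1 : S * (-(J * Sᵀ * J)) = 1 := by
    have : S * (-(J * Sᵀ * J)) = -(S * J * Sᵀ * J) := by noncomm_ring
    rw [this, hS, hJ, neg_neg]
  have h2 : -(J * Sᵀ * J) * S = 1 := mul_eq_one_comm.mp h1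
  calc Sᵀ * J * S = -(J * J) * (Sᵀ * J * S) := by rw [hJ]; simp
    _ = J * (-(J * Sᵀ * J) * S) := by noncomm_ring
    _ = J := by rw [h2, mul_one]

lemma Ent_symplectic_conj {N : ℕ} {S : Matrix (Fin (2 * N)) (Fin (2 * N)) ℝ}
    (hS : IsSymplectic S) (M : Matrix (Fin (2 * N)) (Fin (2 * N)) ℝ) :
    Ent (S * M * Sᵀ) = Ent M := by
  have key : (Complex.I • ((Jmat (2 * N) * (S * M * Sᵀ)).map Complex.ofReal)).charpoly =
      (Complex.I • ((Jmat (2 * N) * M).map Complex.ofReal)).charpoly := by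
    let φ := (Complex.ofRealHom).mapMatrix (m := Fin (2 * N))
    set J := Jmat (2 * N)
    change (Complex.I • φ (J * (S * M * Sᵀ))).charpoly = (Complex.I • φ (J * M)).charpoly
    have h1 : Complex.I • φ (J * (S * M * Sᵀ)) = φ (J * S) * (Complex.I • φ (M * Sᵀ)) := by
      rw [Matrix.mul_smul, ← map_mul]
      simp only [mul_assoc]
    have h2 : (Complex.I • φ (M * Sᵀ)) * φ (J * S) = (Complex.I • φ M) * φ J := by
      have h3 : M * Sᵀ * (J * S) = M * J := by
        calc M * Sᵀ * (J * S) = M * (Sᵀ * J * S) := by simp only [mul_assoc]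
          _ = M * J := by rw [hS.transpose_mul_Jmat_mul]
      rw [Matrix.smul_mul, Matrix.smul_mul, ← map_mul, ← map_mul, h3]
    rw [h1, charpoly_mul_comm, h2, charpoly_mul_comm, Matrix.mul_smul, ← map_mul]
  unfold Ent
  rw [key]

lemma sum_fin_two_mul {N : ℕ} (f : Fin (2 * N) → ℝ) :
    ∑ i, f i = ∑ l : Fin N, (f ⟨2 * l, by omega⟩ + f ⟨2 * l + 1, by omega⟩) := by
  rw [← (finProdFinEquiv.trans (finCongr (mul_comm N 2))).sum_comp, Fintype.sum_prod_type]
  refine Finset.sum_congr rfl fun l _ => ?_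
  rw [Fin.sum_univ_two]
  congr 2 <;> ext <;> simp [add_comm]

/-- The resolvent of `i·J·D(λ)` at a real point of `[-1, 1]`, paired with `i·J·X`. -/
lemma resolvent_Jmat_mul_diagonal {N : ℕ} {lam : ℕ → ℝ} (hlam : ∀ l < N, 1 < lam l)
    (X : Matrix (Fin (2 * N)) (Fin (2 * N)) ℝ) {s : ℝ} (hs : s ∈ Set.Icc (-1 : ℝ) 1) :
    (scalar (Fin (2 * N)) (s : ℂ) -
        Complex.I • (Jmat (2 * N) * Dmat (2 * N) lam).map Complex.ofReal).det ≠ 0 ∧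
    (((scalar (Fin (2 * N)) (s : ℂ) -
        Complex.I • (Jmat (2 * N) * Dmat (2 * N) lam).map Complex.ofReal)⁻¹ *
        -(Complex.I • (Jmat (2 * N) * X).map Complex.ofReal)).trace).re =
      ∑ i : Fin (2 * N), lam (i / 2) / (lam (i / 2) ^ 2 - s ^ 2) * X i i := by
  let φ := (Complex.ofRealHom).mapMatrix (m := Fin (2 * N))
  set J := Jmat (2 * N)
  set D := Dmat (2 * N) lam
  have hJJ : J * J = -1 := Jmat_mul_self N
  have hJD : J * D = D * J := Jmat_mul_diagonal _ lam
  let e : Matrix (Fin (2 * N)) (Fin (2 * N)) ℝ :=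
    diagonal fun i => (lam (i / 2) ^ 2 - s ^ 2)⁻¹
  have hJe : J * e = e * J := Jmat_mul_diagonal _ fun l => (lam l ^ 2 - s ^ 2)⁻¹
  have hne (i : Fin (2 * N)) : lam (i / 2) ^ 2 - s ^ 2 ≠ 0 := by
    have := hlam (i / 2) (by omega)
    nlinarith [hs.1, hs.2]
  have hKK : J * D * (J * D) = -(D * D) := by
    calc J * D * (J * D) = J * (D * J) * D := by noncomm_ring
      _ = J * J * (D * D) := by rw [← hJD]; noncomm_ring
      _ = -(D * D) := by rw [hJJ]; noncomm_ring
  have he : (D * D - s ^ 2 • (1 : Matrix _ _ ℝ)) * e = 1 := by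
    simp only [D, e, Dmat, diagonal_mul_diagonal, smul_one_eq_diagonal, diagonal_sub]
    rw [← diagonal_one]
    congr 1
    ext i
    have := hne i
    field_simp
  have hscal : scalar (Fin (2 * N)) (s : ℂ) = φ (s • 1) := by
    ext i j
    by_cases h : i = j <;> simp [φ, scalar_apply, h]
  let W := -((φ (s • 1) + Complex.I • φ (J * D)) * φ e)
  have hII (Y Z : Matrix (Fin (2 * N)) (Fin (2 * N)) ℝ) :
      (Complex.I • φ Y) * (Complex.I • φ Z) = -φ (Y * Z) := by
    rw [smul_mul_smul_comm, Complex.I_mul_I, ← map_mul, neg_one_smul]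
  have hW : (φ (s • 1) - Complex.I • φ (J * D)) * W = 1 := by
    have h1 : (φ (s • 1) - Complex.I • φ (J * D)) * (φ (s • 1) + Complex.I • φ (J * D)) =
        -φ (D * D - s ^ 2 • 1) := by
      have hcomm : φ (s • 1) * (Complex.I • φ (J * D)) =
          (Complex.I • φ (J * D)) * φ (s • 1) := by
        rw [Matrix.mul_smul, Matrix.smul_mul, ← map_mul, ← map_mul]
        simp
      rw [sub_mul, mul_add, mul_add, hII, hKK, hcomm, ← map_mul, map_neg, map_sub]
      have : (s • (1 : Matrix (Fin (2 * N)) (Fin (2 * N)) ℝ)) * s • 1 = s ^ 2 • 1 := by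
        rw [smul_mul_smul_comm, mul_one, sq]
      rw [this]
      abel
    simp only [W]
    rw [mul_neg, ← mul_assoc, h1, neg_mul, neg_neg, ← map_mul, he, map_one]
  have hinv := inv_eq_right_inv hW
  rw [hscal]
  change (φ (s • 1) - Complex.I • φ (J * D)).det ≠ 0 ∧
    (((φ (s • 1) - Complex.I • φ (J * D))⁻¹ * -(Complex.I • φ (J * X))).trace).re = _
  refine ⟨(isUnit_det_of_right_inverse hW).ne_zero, ?_⟩
  rw [hinv]
  have hWC : W * -(Complex.I • φ (J * X)) =
      Complex.I • φ (s • 1 * e * (J * X)) + φ (D * e * X) := by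
    have h2 : J * D * e * (J * X) = -(D * e * X) := by
      calc J * D * e * (J * X) = J * D * (e * J) * X := by noncomm_ring
        _ = J * (D * J) * e * X := by rw [← hJe]; noncomm_ring
        _ = J * J * (D * e * X) := by rw [← hJD]; noncomm_ring
        _ = -(D * e * X) := by rw [hJJ]; noncomm_ring
    simp only [W]
    rw [neg_mul_neg, add_mul, add_mul, ← map_mul, Matrix.mul_smul, ← map_mul,
      Matrix.smul_mul (Complex.I), ← map_mul φ (J * D), hII, h2, map_neg, neg_neg]
  have htr (Y : Matrix (Fin (2 * N)) (Fin (2 * N)) ℝ) : (φ Y).trace = (Y.trace : ℂ) := by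
    simp [φ, trace]
  rw [hWC, trace_add, trace_smul, htr, htr]
  simp only [smul_eq_mul, Complex.add_re, Complex.mul_re, Complex.I_re, Complex.I_im,
    Complex.ofReal_re, Complex.ofReal_im, D, e, Dmat, diagonal_mul_diagonal, trace, diag_apply,
    diagonal_mul]
  simp [div_eq_mul_inv]

lemma Ent_eq_integral {d : ℕ} {D X : Matrix (Fin d) (Fin d) ℝ} (hD : D.transpose = D)
    (hX : X.transpose = X) {t : ℝ}
    (hpos : ∀ v, v ≠ 0 →
      star v ⬝ᵥ ((D.map Complex.ofReal + (t : ℂ) • X.map Complex.ofReal) *ᵥ v) ≠ 0)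
    (hdet : ∀ s ∈ Set.Icc (-1 : ℝ) 1,
      (Matrix.scalar (Fin d) (s : ℂ) - Complex.I • (Jmat d * D).map Complex.ofReal +
        (t : ℂ) • -(Complex.I • (Jmat d * X).map Complex.ofReal)).det ≠ 0) :
    Ent (D + t • X) =
      1 / 4 * (∫ s in (-1 : ℝ)..1, Real.log ‖(Matrix.scalar (Fin d) (s : ℂ) -
        Complex.I • (Jmat d * D).map Complex.ofReal +
        (t : ℂ) • -(Complex.I • (Jmat d * X).map Complex.ofReal)).det‖) +
      d * ((1 - Real.log 2) / 2) := by
  let φ := (Complex.ofRealHom).mapMatrix (m := Fin d)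
  have hφ (Y : Matrix (Fin d) (Fin d) ℝ) : Y.map Complex.ofReal = φ Y := rfl
  have hφs (Y : Matrix (Fin d) (Fin d) ℝ) : φ (t • Y) = (t : ℂ) • φ Y := by
    ext i j
    simp [φ]
  have hherm {Y : Matrix (Fin d) (Fin d) ℝ} (hY : Y.transpose = Y) : (φ Y).IsHermitian := by
    ext i j
    have : Y j i = Y i j := congrFun (congrFun hY i) j
    simp [φ, this]
  set p := (Complex.I • ((Jmat d * (D + t • X)).map Complex.ofReal)).charpoly with hp
  have heval (s : ℝ) : (Matrix.scalar (Fin d) (s : ℂ) -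
        Complex.I • (Jmat d * D).map Complex.ofReal +
        (t : ℂ) • -(Complex.I • (Jmat d * X).map Complex.ofReal)).det =
      (p.roots.map fun z => (s : ℂ) - z).prod := by
    rw [← (IsAlgClosed.splits p).eval_eq_prod_roots_of_monic (charpoly_monic _), hp,
      eval_charpoly]
    simp only [hφ, mul_add, map_add, Matrix.mul_smul, hφs, smul_add]
    congr 1
    rw [smul_neg, smul_comm]
    abel
  have hroots : ∀ z ∈ p.roots, z.im = 0 ∧ 1 < |z.re| := by
    intro z hz
    have him : z.im = 0 := by
      have hJ : (Complex.I • φ (Jmat d)).IsHermitian := by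
        ext i j
        have : Jmat d j i = -Jmat d i j := congrFun (congrFun (Jmat_transpose d) i) j
        simp [φ, this]
      have hz' := Polynomial.isRoot_of_mem_roots hz
      rw [hp, hφ, map_mul, ← Matrix.smul_mul] at hz'
      refine im_eq_zero_of_isRoot_charpoly_mul hJ (hherm ?_) ?_ hz'
      · rw [transpose_add, transpose_smul, hD, hX]
      · rw [map_add, hφs]
        exact hpos
    refine ⟨him, not_le.mp fun hle => hdet z.re (abs_le.mp hle) ?_⟩
    rw [heval]
    refine Multiset.prod_eq_zero (Multiset.mem_map.mpr ⟨z, hz, ?_⟩)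
    apply Complex.ext <;> simp [him]
  have hcard : (p.roots.card : ℝ) = d := by
    rw [← (IsAlgClosed.splits p).natDegree_eq_card_roots, hp, charpoly_natDegree_eq_dim,
      Fintype.card_fin]
  simp only [heval]
  rw [(integral_log_norm_multiset_prod p.roots hroots).2, hcard, Ent, ← hp]
  ring

end Algebraic

/-- Rate of entropy increase under partial diffusion (Lemma 4.3). -/
theorem entropy_rate_partial_diffusion (m n : ℕ) (hm : 1 ≤ m) (hn : 1 ≤ n)
    (M : Matrix (Fin (2 * (m + n))) (Fin (2 * (m + n))) ℝ)
    (hsymm : M.IsSymm) (hpd : M.PosDef)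
    (S : Matrix (Fin (2 * (m + n))) (Fin (2 * (m + n))) ℝ) (hS : IsSymplectic S)
    (lam : ℕ → ℝ) (hdiag : S * M * S.transpose = Dmat (2 * (m + n)) lam)
    (hlam : ∀ ℓ < m + n, 1 < lam ℓ) :
    HasDerivAt (fun t : ℝ => Ent (M + t • IA0B (2 * (m + n)) (2 * m)))
      (1 / 4 * ∑ ℓ : Fin (m + n), betaFn (lam ℓ) *
        ((S * IA0B (2 * (m + n)) (2 * m) * S.transpose)
            ⟨2 * ℓ, by have := ℓ.isLt; omega⟩ ⟨2 * ℓ, by have := ℓ.isLt; omega⟩ +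
         (S * IA0B (2 * (m + n)) (2 * m) * S.transpose)
            ⟨2 * ℓ + 1, by have := ℓ.isLt; omega⟩ ⟨2 * ℓ + 1, by have := ℓ.isLt; omega⟩))
      0 := by
  set P := IA0B (2 * (m + n)) (2 * m)
  set D := Dmat (2 * (m + n)) lam with hD
  set J := Jmat (2 * (m + n))
  set X := S * P * S.transpose with hX
  have hsum : ∫ s in (-1 : ℝ)..1,
      (((Matrix.scalar (Fin (2 * (m + n))) (s : ℂ) - Complex.I • (J * D).map Complex.ofReal)⁻¹ *
        -(Complex.I • (J * X).map Complex.ofReal)).trace).re =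
      ∑ i : Fin (2 * (m + n)), betaFn (lam (i / 2)) * X i i := by
    have hcongr : Set.EqOn (fun s : ℝ => (((Matrix.scalar (Fin (2 * (m + n))) (s : ℂ) -
          Complex.I • (J * D).map Complex.ofReal)⁻¹ *
          -(Complex.I • (J * X).map Complex.ofReal)).trace).re)
        (fun s : ℝ => ∑ i : Fin (2 * (m + n)), lam (i / 2) / (lam (i / 2) ^ 2 - s ^ 2) * X i i)
        (Set.uIcc (-1) 1) := by
      intro s hs
      rw [Set.uIcc_of_le (by norm_num)] at hs
      exact (resolvent_Jmat_mul_diagonal hlam X hs).2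
    rw [intervalIntegral.integral_congr hcongr, intervalIntegral.integral_finsetSum]
    · refine Finset.sum_congr rfl fun i _ => ?_
      rw [intervalIntegral.integral_mul_const, integral_div_sq_sub_sq (hlam _ (by omega))]
    · intro i _
      refine ContinuousOn.intervalIntegrable (ContinuousOn.mul (ContinuousOn.div (by fun_prop)
        (by fun_prop) fun s hs => ?_) (by fun_prop))
      rw [Set.uIcc_of_le (by norm_num)] at hs
      have := hlam (i / 2) (by omega)
      nlinarith [hs.1, hs.2]
  have hint := hasDerivAt_integral_log_norm_det (Complex.I • (J * D).map Complex.ofReal)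
    (-(Complex.I • (J * X).map Complex.ofReal))
    fun s hs => (resolvent_Jmat_mul_diagonal hlam X hs).1
  rw [hsum] at hint
  have hval : 1 / 4 * ∑ i : Fin (2 * (m + n)), betaFn (lam (i / 2)) * X i i =
      1 / 4 * ∑ ℓ : Fin (m + n), betaFn (lam ℓ) *
        (X ⟨2 * ℓ, by have := ℓ.isLt; omega⟩ ⟨2 * ℓ, by have := ℓ.isLt; omega⟩ +
         X ⟨2 * ℓ + 1, by have := ℓ.isLt; omega⟩ ⟨2 * ℓ + 1, by have := ℓ.isLt; omega⟩) := by
    rw [sum_fin_two_mul]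
    congr 1
    refine Finset.sum_congr rfl fun l _ => ?_
    have h1 : 2 * (l : ℕ) / 2 = l := by omega
    have h2 : (2 * (l : ℕ) + 1) / 2 = l := by omega
    simp only [h1, h2]
    ring
  rw [← hval]
  have hXs : X.transpose = X := by
    simp [hX, P, IA0B, Matrix.transpose_mul, mul_assoc]
  have hposdef : (D.map Complex.ofReal).PosDef := by
    rw [hD, Dmat, Matrix.diagonal_map (by simp)]
    refine Matrix.PosDef.diagonal fun i => ?_
    have := hlam (i / 2) (by omega)
    exact Complex.zero_lt_real.mpr (by linarith)
  refine ((hint.const_mul (1 / 4)).add_const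
    ((2 * (m + n) : ℕ) * ((1 - Real.log 2) / 2))).congr_of_eventuallyEq ?_
  filter_upwards [eventually_dotProduct_mulVec_ne_zero hposdef (X.map Complex.ofReal),
    eventually_det_ne_zero (Complex.I • (J * D).map Complex.ofReal)
      (-(Complex.I • (J * X).map Complex.ofReal))
      fun s hs => (resolvent_Jmat_mul_diagonal hlam X hs).1] with t htpos htdet
  have hconj : S * (M + t • P) * S.transpose = D + t • X := by
    rw [Matrix.mul_add, Matrix.add_mul, hdiag, Matrix.mul_smul, Matrix.smul_mul]
  rw [← Ent_symplectic_conj hS, hconj]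
  exact Ent_eq_integral (Matrix.diagonal_transpose _) hXs htpos htdet

end
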